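/- arXiv:1503.02478 — 2 statements merged into one kernel-verified Lean document; each statement's English description precedes it below -/
import Mathlib

section
/- For every ε > 0 there exists r₀ > 0 such that for every z ∈ 𝒮 with Re z ≥ r₀ and every x ∈ ℝ, one has ∫_ℝ |R_z(x,y)| dy ≤ 4·(1+ε)·Re z/(1−|Im z|). -/
open MeasureTheory Complex Set

noncomputable def kp (z : ℂ) : ℂ := (Complex.I - z) ^ (1/2 : ℂ)
noncomputable def km (z : ℂ) : ℂ := (-Complex.I - z) ^ (1/2 : ℂ)

def SigmaSet : Set ℂ := {z : ℂ | 0 ≤ z.re ∧ (z.im = 1 ∨ z.im = -1)}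

def Sset : Set ℂ := {z : ℂ | 0 ≤ z.re ∧ |z.im| < 1}

noncomputable def Rker (z : ℂ) (x y : ℝ) : ℂ :=
  if 0 ≤ x ∧ y ≤ 0 then Complex.exp (-(kp z) * (x : ℂ) + km z * (y : ℂ)) / (kp z + km z)
  else if x ≤ 0 ∧ 0 ≤ y then Complex.exp (km z * (x : ℂ) - kp z * (y : ℂ)) / (kp z + km z)
  else if 0 ≤ x then
    Complex.exp (-(kp z) * (|x - y| : ℝ)) / (2 * kp z)
      + (kp z - km z) * Complex.exp (-(kp z) * ((x : ℂ) + (y : ℂ))) / (2 * kp z * (kp z + km z))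
  else
    Complex.exp (-(km z) * (|x - y| : ℝ)) / (2 * km z)
      - (kp z - km z) * Complex.exp (km z * ((x : ℂ) + (y : ℂ))) / (2 * km z * (kp z + km z))

/-- The two-sided decaying exponential is integrable, with integral `2 / a`. -/
theorem integrable_exp_neg_mul_abs_sub {a : ℝ} (ha : 0 < a) (x : ℝ) :
    Integrable (fun y : ℝ => Real.exp (-a * |x - y|)) ∧
      ∫ y : ℝ, Real.exp (-a * |x - y|) = 2 / a := by
  have h : ∫ y : ℝ, Real.exp (-a * |x - y|) = 2 / a := by
    rw [integral_sub_left_eq_self (fun y : ℝ => Real.exp (-a * |y|)) volume x,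
      integral_comp_abs (f := fun y : ℝ => Real.exp (-a * y)),
      integral_exp_mul_Ioi (by linarith) 0]
    field_simp
    simp
  refine ⟨by_contra fun hn => ?_, h⟩
  rw [integral_undef hn] at h
  have : 0 < 2 / a := by positivity
  linarith

/-- The kernel restricted to a fixed `x ≥ 0`, as a function of `y`. -/
noncomputable def halfKernel (p q : ℂ) (x y : ℝ) : ℂ :=
  if y ≤ 0 then Complex.exp (-p * (x : ℂ) + q * (y : ℂ)) / (p + q)
  else Complex.exp (-p * (|x - y| : ℝ)) / (2 * p)
      + (p - q) * Complex.exp (-p * ((x : ℂ) + (y : ℂ))) / (2 * p * (p + q))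

theorem norm_halfKernel_le {p q : ℂ} (hp : 0 < p.re) {x : ℝ} (hx : 0 ≤ x) (y : ℝ) :
    ‖halfKernel p q x y‖ ≤
      (Iic (0 : ℝ)).indicator (fun y => Real.exp (q.re * y)) y * (1 / ‖p + q‖)
      + Real.exp (-p.re * |x - y|) * (1 / (2 * ‖p‖))
      + (Ioi (0 : ℝ)).indicator (fun y => Real.exp (-p.re * y)) y
          * (‖p - q‖ / (2 * ‖p‖ * ‖p + q‖)) := by
  have hpx : 0 ≤ p.re * x := by positivity
  unfold halfKernel
  split_ifs with hy
  · have h1 : ‖Complex.exp (-p * (x : ℂ) + q * (y : ℂ))‖ ≤ Real.exp (q.re * y) := by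
      rw [Complex.norm_exp, Real.exp_le_exp]
      simp
      linarith
    rw [indicator_of_mem (show y ∈ Iic (0 : ℝ) from hy),
      indicator_of_notMem (show y ∉ Ioi (0 : ℝ) from not_lt.2 hy), norm_div, div_eq_mul_one_div]
    have h2 : ‖Complex.exp (-p * (x : ℂ) + q * (y : ℂ))‖ * (1 / ‖p + q‖)
        ≤ Real.exp (q.re * y) * (1 / ‖p + q‖) := by gcongr
    have h3 : 0 ≤ Real.exp (-p.re * |x - y|) * (1 / (2 * ‖p‖)) := by positivity
    linarith
  · have h1 : ‖Complex.exp (-p * ((x : ℂ) + (y : ℂ)))‖ ≤ Real.exp (-p.re * y) := by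
      rw [Complex.norm_exp, Real.exp_le_exp]
      simp
      linarith
    have h2 : ‖Complex.exp (-p * (|x - y| : ℝ))‖ = Real.exp (-p.re * |x - y|) := by
      rw [Complex.norm_exp, Complex.re_mul_ofReal, Complex.neg_re]
    rw [indicator_of_notMem (show y ∉ Iic (0 : ℝ) from hy),
      indicator_of_mem (show y ∈ Ioi (0 : ℝ) from not_le.1 hy), zero_mul, zero_add]
    refine (norm_add_le _ _).trans (add_le_add (le_of_eq ?_) ?_)
    · rw [norm_div, h2, norm_mul, Complex.norm_ofNat, div_eq_mul_one_div]
    · rw [norm_div, norm_mul, norm_mul, norm_mul, Complex.norm_ofNat, mul_comm ‖p - q‖,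
        mul_div_assoc]
      gcongr

theorem integral_norm_halfKernel_le {p q : ℂ} (hp : 0 < p.re) (hq : 0 < q.re) {x : ℝ}
    (hx : 0 ≤ x) :
    ∫ y : ℝ, ‖halfKernel p q x y‖ ≤
      1 / q.re * (1 / ‖p + q‖) + 2 / p.re * (1 / (2 * ‖p‖))
        + 1 / p.re * (‖p - q‖ / (2 * ‖p‖ * ‖p + q‖)) := by
  obtain ⟨hi2, he2⟩ := integrable_exp_neg_mul_abs_sub hp x
  have hi1 : Integrable ((Iic (0 : ℝ)).indicator (fun y => Real.exp (q.re * y))) :=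
    (integrable_indicator_iff measurableSet_Iic).2 (integrableOn_exp_mul_Iic hq 0)
  have hi3 : Integrable ((Ioi (0 : ℝ)).indicator (fun y => Real.exp (-p.re * y))) :=
    (integrable_indicator_iff measurableSet_Ioi).2
      (integrableOn_exp_mul_Ioi (by linarith) 0)
  have he1 : ∫ y, (Iic (0 : ℝ)).indicator (fun y => Real.exp (q.re * y)) y = 1 / q.re := by
    rw [integral_indicator measurableSet_Iic, integral_exp_mul_Iic hq]
    simp
  have he3 : ∫ y, (Ioi (0 : ℝ)).indicator (fun y => Real.exp (-p.re * y)) y = 1 / p.re := by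
    rw [integral_indicator measurableSet_Ioi, integral_exp_mul_Ioi (by linarith)]
    simp
  have hj1 := hi1.mul_const (1 / ‖p + q‖)
  have hj2 := hi2.mul_const (1 / (2 * ‖p‖))
  have hj3 := hi3.mul_const (‖p - q‖ / (2 * ‖p‖ * ‖p + q‖))
  refine (integral_mono_of_nonneg (Filter.Eventually.of_forall fun y => norm_nonneg _)
    ((hj1.add hj2).add hj3)
    (Filter.Eventually.of_forall fun y => norm_halfKernel_le hp hx y)).trans (le_of_eq ?_)
  refine (integral_add (hj1.add hj2) hj3).trans ?_
  simp only [Pi.add_apply]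
  rw [integral_add hj1 hj2, integral_mul_const,
    integral_mul_const, integral_mul_const, he1, he2, he3]

theorem integral_norm_halfKernel_le_of_sq {p q : ℂ} (hp : 0 < p.re) (hq : 0 < q.re)
    {r t u : ℝ} (hr : 1 ≤ r) (ht : 0 < t) (hu : 0 < u) (htu : t + u = 2)
    (hp2 : p.im ^ 2 = r + p.re ^ 2) (hq2 : q.im ^ 2 = r + q.re ^ 2)
    (hpt : 2 * p.re * |p.im| = t) (hqu : 2 * q.re * |q.im| = u)
    (hpq : ‖p - q‖ * ‖p + q‖ = 2) {x : ℝ} (hx : 0 ≤ x) :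
    ∫ y : ℝ, ‖halfKernel p q x y‖ ≤ (4 * r + 20) / (t * u) := by
  have hr0 : 0 < r := by linarith
  obtain ⟨m, hm0, hm⟩ : ∃ m : ℝ, 0 < m ∧ m ^ 2 = r := ⟨√r, by positivity, Real.sq_sqrt hr0.le⟩
  obtain ⟨N, hN0, hN⟩ : ∃ N : ℝ, 0 < N ∧ N ^ 2 = r + 5 / 4 :=
    ⟨√(r + 5 / 4), by positivity, Real.sq_sqrt (by positivity)⟩
  have key : ∀ w : ℂ, 0 < w.re → w.im ^ 2 = r + w.re ^ 2 → 2 * w.re * |w.im| ≤ 2 →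
      m ≤ |w.im| ∧ w.re ≤ 1 ∧ |w.im| ≤ N := by
    intro w hw h1 h2
    have h0 := abs_nonneg w.im
    rw [← sq_abs] at h1
    have hmw : m ≤ |w.im| := by nlinarith
    have h1m : 1 ≤ m := by nlinarith
    have hre : w.re ≤ 1 := by nlinarith
    exact ⟨hmw, hre, by nlinarith⟩
  obtain ⟨hmp, hp1, hpN⟩ := key p hp hp2 (by linarith)
  obtain ⟨hmq, hq1, hqN⟩ := key q hq hq2 (by linarith)
  have hsub : ‖p - q‖ ≤ 2 * N := by
    have h1 : ‖p - q‖ ^ 2 = (p.re - q.re) ^ 2 + (p.im - q.im) ^ 2 := by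
      rw [Complex.sq_norm, Complex.normSq_apply]
      simp
      ring
    have h2 : (p.im - q.im) ^ 2 ≤ 2 * p.im ^ 2 + 2 * q.im ^ 2 := by
      nlinarith [sq_nonneg (p.im + q.im)]
    have h3 : (p.re - q.re) ^ 2 + 2 * p.re ^ 2 + 2 * q.re ^ 2 ≤ 5 := by
      nlinarith [mul_pos hp hq]
    exact abs_le_of_sq_le_sq' (by nlinarith) (by positivity) |>.2
  have hsum : 0 < ‖p + q‖ := by
    rcases (norm_nonneg (p + q)).eq_or_lt with h | h
    · rw [← h] at hpq; simp at hpq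
    · exact h
  have hinv : 1 / ‖p + q‖ ≤ N := by
    rw [div_le_iff₀ hsum]
    linarith [mul_le_mul_of_nonneg_right hsub hsum.le]
  have hnp : m ≤ ‖p‖ := hmp.trans (Complex.abs_im_le_norm p)
  have hpi : 1 / p.re ≤ 2 * N / t := by
    rw [div_le_div_iff₀ hp ht]
    linarith [mul_le_mul_of_nonneg_left hpN hp.le]
  have hqi : 1 / q.re ≤ 2 * N / u := by
    rw [div_le_div_iff₀ hq hu]
    linarith [mul_le_mul_of_nonneg_left hqN hq.le]
  have hNm : N / m ≤ 1 + 5 / (8 * r) := by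
    have h1 : 1 + 5 / (8 * r) = (r + 5 / 8) / r := by field_simp
    rw [h1, div_le_div_iff₀ hm0 hr0]
    have h2 : N * m ≤ r + 5 / 8 := by linarith [sq_nonneg (N - m), sub_sq N m]
    rw [← hm] at h2 ⊢
    linarith [mul_le_mul_of_nonneg_right h2 hm0.le]
  have hr1 : 5 / (8 * r) ≤ 5 / 8 := by
    rw [div_le_div_iff₀ (by positivity) (by positivity)]
    linarith
  have hr2 : r * (5 / (8 * r)) = 5 / 8 := by field_simp
  have b1 : 1 / q.re * (1 / ‖p + q‖) ≤ (2 * r + 6) / u := by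
    calc _ ≤ 2 * N / u * N := by gcongr
      _ = 2 * N ^ 2 / u := by ring
      _ ≤ _ := by gcongr; linarith
  have b2 : 2 / p.re * (1 / (2 * ‖p‖)) ≤ 4 / t := by
    calc _ = 1 / p.re * (1 / ‖p‖) := by field_simp
      _ ≤ 2 * N / t * (1 / m) := by gcongr
      _ = 2 * (N / m) / t := by ring
      _ ≤ _ := by gcongr; linarith
  have b3 : 1 / p.re * (‖p - q‖ / (2 * ‖p‖ * ‖p + q‖)) ≤ (2 * r + 6) / t := by
    calc _ = 1 / p.re * (‖p - q‖ * (1 / ‖p + q‖) / (2 * ‖p‖)) := by field_simp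
      _ ≤ 2 * N / t * (2 * N * N / (2 * m)) := by gcongr
      _ = 2 * (N ^ 2 * (N / m)) / t := by field_simp
      _ ≤ _ := by
        gcongr
        rw [hN]
        linarith [mul_le_mul_of_nonneg_left hNm (show 0 ≤ r + 5 / 4 by positivity)]
  have hsplit : (4 * r + 20) / (t * u) = (2 * r + 10) / t + (2 * r + 10) / u := by
    rw [div_add_div _ _ ht.ne' hu.ne']
    congr 1
    linear_combination -(2 * r + 10) * htu
  have b4 : (2 * r + 6) / t + 4 / t = (2 * r + 10) / t := by ring
  have b5 : (2 * r + 6) / u ≤ (2 * r + 10) / u := by gcongr; linarith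
  have := integral_norm_halfKernel_le hp hq hx
  linarith

theorem cpow_half_sq (w : ℂ) : (w ^ (1 / 2 : ℂ)) ^ 2 = w := by
  have := Complex.cpow_nat_inv_pow w (n := 2) two_ne_zero
  rwa [← one_div, Nat.cast_ofNat] at this

theorem cpow_half_re_pos {w : ℂ} (hw : w.im ≠ 0) : 0 < (w ^ (1 / 2 : ℂ)).re := by
  have h0 : w ≠ 0 := fun h => hw (by simp [h])
  rw [Complex.cpow_def_of_ne_zero h0, Complex.exp_re]
  have him : (Complex.log w * (1 / 2)).im = w.arg / 2 := by
    rw [mul_one_div, Complex.div_ofNat_im, Complex.log_im]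
  rw [him]
  have h1 := Complex.neg_pi_lt_arg w
  have h2 : w.arg < Real.pi := (Complex.arg_le_pi w).lt_of_ne fun h =>
    hw (Complex.arg_eq_pi_iff.1 h).2
  exact mul_pos (Real.exp_pos _) (Real.cos_pos_of_mem_Ioo ⟨by linarith, by linarith⟩)

theorem Rker_eq_halfKernel {z : ℂ} (hp : kp z ≠ 0) (hs : kp z + km z ≠ 0) {x : ℝ} (hx : 0 ≤ x)
    (y : ℝ) : Rker z x y = halfKernel (kp z) (km z) x y := by
  unfold Rker halfKernel
  by_cases hy : y ≤ 0
  · simp [hx, hy]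
  · have hy' : 0 < y := not_le.1 hy
    rcases hx.eq_or_lt with rfl | hx'
    · simp only [hy, hy'.le, and_false, and_self, le_refl, if_true, if_false, zero_sub, abs_neg,
        abs_of_pos hy', Complex.ofReal_zero, mul_zero, zero_add, neg_mul]
      field_simp
      ring
    · simp [hx, hy, not_le.2 hx']

theorem Rker_neg_eq_halfKernel {z : ℂ} (hm : km z ≠ 0) (hs : kp z + km z ≠ 0) {x : ℝ}
    (hx : 0 ≤ x) (y : ℝ) : Rker z (-x) (-y) = halfKernel (km z) (kp z) x y := by
  have hs' : km z + kp z ≠ 0 := by rwa [add_comm]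
  unfold Rker halfKernel
  by_cases hy : y ≤ 0
  · by_cases h : 0 ≤ -x ∧ -y ≤ 0
    · obtain rfl : x = 0 := by linarith [h.1]
      obtain rfl : y = 0 := by linarith [h.2]
      simp [add_comm]
    · rw [if_neg h, if_pos ⟨by linarith, by linarith⟩, if_pos hy, add_comm (km z)]
      push_cast
      congr 2
      ring
  · have hy' : 0 < y := not_le.1 hy
    rw [if_neg hy]
    rcases hx.eq_or_lt with rfl | hx'
    · rw [if_pos ⟨by simp, by linarith⟩]
      simp only [zero_sub, abs_neg, abs_of_pos hy', Complex.ofReal_zero, mul_zero, zero_add,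
        neg_mul, neg_zero, Complex.ofReal_neg, mul_neg]
      field_simp
      ring
    · rw [if_neg fun h => by linarith [h.1], if_neg fun h => by linarith [h.2],
        if_neg (by linarith), show -x - -y = -(x - y) by ring, abs_neg]
      have he : km z * (((-x : ℝ) : ℂ) + ((-y : ℝ) : ℂ)) = -km z * ((x : ℂ) + (y : ℂ)) := by
        push_cast
        ring
      rw [he, add_comm (kp z)]
      ring

theorem stmt5 : ∀ ε : ℝ, 0 < ε → ∃ r₀ : ℝ, 0 < r₀ ∧
    ∀ z : ℂ, z ∈ Sset → r₀ ≤ z.re → ∀ x : ℝ,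
      (∫ y : ℝ, ‖Rker z x y‖) ≤ 4 * (1 + ε) * z.re / (1 - |z.im|) := by
  intro ε hε
  refine ⟨max 1 (5 / ε), by positivity, fun z hz hr x => ?_⟩
  have hr1 : 1 ≤ z.re := (le_max_left _ _).trans hr
  have hr2 : 5 ≤ ε * z.re := by
    have := (le_max_right _ _).trans hr
    rwa [div_le_iff₀ hε, mul_comm] at this
  obtain ⟨hs1, hs2⟩ := abs_lt.1 hz.2
  have hp : 0 < (kp z).re := cpow_half_re_pos (by simp; linarith)
  have hq : 0 < (km z).re := cpow_half_re_pos (by simp; linarith)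
  have hpsq : kp z ^ 2 = Complex.I - z := cpow_half_sq _
  have hqsq : km z ^ 2 = -Complex.I - z := cpow_half_sq _
  have hprod : ‖kp z - km z‖ * ‖kp z + km z‖ = 2 := by
    rw [← norm_mul, show (kp z - km z) * (kp z + km z) = 2 * Complex.I by
      linear_combination hpsq - hqsq]
    simp
  have hpre := congrArg Complex.re hpsq
  have hpim := congrArg Complex.im hpsq
  have hqre := congrArg Complex.re hqsq
  have hqim := congrArg Complex.im hqsq
  simp only [sq, Complex.mul_re, Complex.mul_im, Complex.sub_re, Complex.sub_im, Complex.I_re,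
    Complex.I_im, Complex.neg_re, Complex.neg_im] at hpre hpim hqre hqim
  have hp2 : (kp z).im ^ 2 = z.re + (kp z).re ^ 2 := by linarith
  have hq2 : (km z).im ^ 2 = z.re + (km z).re ^ 2 := by linarith
  have hpt : 2 * (kp z).re * |(kp z).im| = 1 - z.im := by
    rw [abs_of_pos (pos_of_mul_pos_right (by linarith) hp.le)]
    linarith
  have hqu : 2 * (km z).re * |(km z).im| = 1 + z.im := by
    rw [abs_of_neg (neg_of_mul_neg_right (by linarith) hq.le)]
    linarith
  have hp0 : kp z ≠ 0 := fun h => by simp [h] at hp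
  have hq0 : km z ≠ 0 := fun h => by simp [h] at hq
  have hsum : kp z + km z ≠ 0 := fun h => by simp [h] at hprod
  have main : ∫ y : ℝ, ‖Rker z x y‖ ≤ (4 * z.re + 20) / ((1 - z.im) * (1 + z.im)) := by
    rcases le_total 0 x with hx | hx
    · simp_rw [Rker_eq_halfKernel hp0 hsum hx]
      exact integral_norm_halfKernel_le_of_sq hp hq hr1 (by linarith) (by linarith) (by ring)
        hp2 hq2 hpt hqu hprod hx
    · rw [← integral_neg_eq_self]
      have hx' : 0 ≤ -x := by linarith
      have := Rker_neg_eq_halfKernel hq0 hsum hx'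
      rw [neg_neg] at this
      simp_rw [this]
      rw [mul_comm (1 - z.im)]
      rw [norm_sub_rev, add_comm] at hprod
      exact integral_norm_halfKernel_le_of_sq hq hp hr1 (by linarith) (by linarith) (by ring)
        hq2 hp2 hqu hpt hprod hx'
  refine main.trans ?_
  have hpos : 0 < 1 - |z.im| := by linarith [hz.2]
  have hfac : 1 - |z.im| ≤ (1 - z.im) * (1 + z.im) := by
    nlinarith [sq_abs z.im, abs_nonneg z.im, hz.2]
  gcongr
  linarith
end

section
/- For every ε > 0 there exists r₀ > 0 such that for every z = τ + i·δ ∈ 𝒮 with τ ≥ r₀ the following holds. Define f₀ : ℝ → ℂ by f₀(y) := e^{−conj(k₊(z))·y} for y > 0 and f₀(y) := 0 for y ≤ 0. Then ∫_ℝ |f₀(y)|² dy = 1/(2·Re k₊(z)), and (∫_ℝ |∫_ℝ R_z(x,y)·f₀(y) dy|² dx)^{1/2} ≥ (1−ε)·(τ/√(1−δ²))·(∫_ℝ |f₀(y)|² dy)^{1/2}. -/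
open MeasureTheory Complex Set

lemma half_cpow_sq (w : ℂ) : (w ^ (1/2 : ℂ)) ^ 2 = w := by
  simp

lemma half_cpow_re_pos {w : ℂ} (hw : w.im ≠ 0) : 0 < (w ^ (1/2 : ℂ)).re := by
  rw [one_div, cpow_inv_two_re]
  have h1 : |w.re| < ‖w‖ := abs_re_lt_norm.mpr hw
  have h2 := neg_abs_le w.re
  exact Real.sqrt_pos.mpr (by linarith)

lemma kp_sq (z : ℂ) : kp z ^ 2 = I - z := half_cpow_sq _

lemma km_sq (z : ℂ) : km z ^ 2 = -I - z := half_cpow_sq _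

lemma kp_re_pos {z : ℂ} (hz : |z.im| < 1) : 0 < (kp z).re := by
  refine half_cpow_re_pos ?_
  have := (abs_lt.mp hz).2
  simp only [sub_im, I_im]
  linarith

lemma km_re_pos {z : ℂ} (hz : |z.im| < 1) : 0 < (km z).re := by
  refine half_cpow_re_pos ?_
  have := (abs_lt.mp hz).1
  simp only [sub_im, neg_im, I_im]
  linarith

/-- The real and imaginary parts of the equation `kp z ^ 2 = I - z`. -/
lemma kp_re_im (z : ℂ) :
    (kp z).re ^ 2 - (kp z).im ^ 2 = -z.re ∧ 2 * (kp z).re * (kp z).im = 1 - z.im := by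
  have h := kp_sq z
  have h1 := congrArg re h
  have h2 := congrArg im h
  simp only [sq, mul_re, mul_im, sub_re, sub_im, I_re, I_im] at h1 h2
  constructor <;> linarith

/-- The real and imaginary parts of the equation `km z ^ 2 = -I - z`. -/
lemma km_re_im (z : ℂ) :
    (km z).re ^ 2 - (km z).im ^ 2 = -z.re ∧ 2 * (km z).re * (km z).im = -1 - z.im := by
  have h := km_sq z
  have h1 := congrArg re h
  have h2 := congrArg im h
  simp only [sq, mul_re, mul_im, sub_re, sub_im, neg_re, neg_im, I_re, I_im] at h1 h2
  constructor <;> linarith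

lemma kp_im_pos {z : ℂ} (hz : |z.im| < 1) : 0 < (kp z).im := by
  have h := (kp_re_im z).2
  have h1 := (abs_lt.mp hz).2
  exact pos_of_mul_pos_right (by linarith : 0 < 2 * (kp z).re * (kp z).im)
    (by linarith [kp_re_pos hz])

lemma km_im_neg {z : ℂ} (hz : |z.im| < 1) : (km z).im < 0 := by
  have h := (km_re_im z).2
  have h1 := (abs_lt.mp hz).1
  by_contra! h2
  have := mul_nonneg (by linarith [km_re_pos hz] : 0 ≤ 2 * (km z).re) h2
  linarith

lemma four_mul_re_mul_re_mul_norm_sq_le {z : ℂ} (hz : |z.im| < 1) (hre : 0 < z.re) :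
    4 * (kp z).re * (km z).re * ‖kp z + km z‖ ^ 2 ≤ (1 - z.im ^ 2) / z.re ^ 2 := by
  obtain ⟨h1, h2⟩ := kp_re_im z
  obtain ⟨h3, h4⟩ := km_re_im z
  have ha := kp_re_pos hz
  have hb := km_re_pos hz
  have hp := kp_im_pos hz
  have hq := km_im_neg hz
  have hprod : ‖kp z + km z‖ ^ 2 * ‖kp z - km z‖ ^ 2 = 4 := by
    rw [← mul_pow, ← norm_mul, ← sq_sub_sq, kp_sq, km_sq]
    have : I - z - (-I - z) = 2 * I := by ring
    rw [this]
    norm_num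
  have hdiff : ((kp z).im - (km z).im) ^ 2 ≤ ‖kp z - km z‖ ^ 2 := by
    rw [Complex.sq_norm, normSq_apply, sub_re, sub_im]
    nlinarith [sq_nonneg ((kp z).re - (km z).re)]
  set a := (kp z).re
  set b := (km z).re
  set p := (kp z).im
  set N := ‖kp z + km z‖ ^ 2
  set M := ‖kp z - km z‖ ^ 2
  obtain ⟨q, hqq⟩ : ∃ q, q = -(km z).im := ⟨_, rfl⟩
  have hq0 : (km z).im = -q := by linarith
  rw [hq0] at h3 h4 hdiff hq
  have hq : 0 < q := by linarith
  have hN : 0 ≤ N := by positivity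
  have hpq : z.re ≤ p * q := by
    have h5 : z.re ≤ p ^ 2 := by nlinarith
    have h6 : z.re ≤ q ^ 2 := by nlinarith
    refine le_of_sq_le_sq ?_ (by positivity)
    nlinarith
  have hNM : N * z.re ≤ 1 := by
    have : 4 * z.re ≤ M := by nlinarith [sq_nonneg (p - q)]
    nlinarith
  have hab : 4 * a * b * (p * q) = 1 - z.im ^ 2 := by
    have : (2 * a * p) * (2 * b * q) = (1 - z.im) * (1 + z.im) := by
      rw [h2, show 2 * b * q = 1 + z.im by linarith]
    linarith
  rw [le_div_iff₀ (by positivity), ← hab]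
  calc 4 * a * b * N * z.re ^ 2 = 4 * a * b * (z.re * (N * z.re)) := by ring
    _ ≤ 4 * a * b * (p * q) := by
      refine mul_le_mul_of_nonneg_left ?_ (by positivity)
      nlinarith

lemma integrableOn_exp_neg_abs_mul_exp {k l : ℂ} (hkl : 0 < (k + l).re) (x : ℝ) (hx : 0 < x) :
    IntegrableOn (fun y : ℝ => exp (-k * (|x - y| : ℝ)) * exp (-l * y)) (Ioi 0) := by
  rw [← Ioc_union_Ioi_eq_Ioi hx.le]
  refine IntegrableOn.union ?_ ?_
  · exact ((by fun_prop : Continuous fun y : ℝ =>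
      exp (-k * (|x - y| : ℝ)) * exp (-l * y)).integrableOn_Icc).mono_set Ioc_subset_Icc_self
  · refine IntegrableOn.congr_fun (f := fun y : ℝ => exp (k * x) * exp (-(k + l) * y))
      ((integrableOn_exp_mul_complex_Ioi (by rw [neg_re]; linarith) x).const_mul _) ?_
      measurableSet_Ioi
    intro y hy
    have : |x - y| = y - x := by rw [abs_of_neg (by linarith [mem_Ioi.mp hy])]; ring
    simp only [this, ← exp_add]
    congr 1
    push_cast
    ring

lemma integral_exp_neg_abs_mul_exp {k l : ℂ} (hkl : 0 < (k + l).re) (hne : k ≠ l)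
    (x : ℝ) (hx : 0 < x) :
    ∫ y : ℝ in Ioi 0, exp (-k * (|x - y| : ℝ)) * exp (-l * y) =
      (exp (-l * x) - exp (-k * x)) / (k - l) + exp (-l * x) / (k + l) := by
  have hint := integrableOn_exp_neg_abs_mul_exp hkl x hx
  have hsub : k - l ≠ 0 := sub_ne_zero.mpr hne
  rw [← Ioc_union_Ioi_eq_Ioi hx.le] at hint ⊢
  rw [setIntegral_union (Ioc_disjoint_Ioi le_rfl) measurableSet_Ioi hint.left_of_union
    hint.right_of_union]
  congr 1
  · rw [setIntegral_congr_fun (g := fun y : ℝ => exp (-k * x) * exp ((k - l) * y))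
      measurableSet_Ioc, integral_const_mul, ← intervalIntegral.integral_of_le hx.le,
      integral_exp_mul_complex hsub, ← mul_div_assoc, mul_sub, ← exp_add, ← exp_add]
    · congr 3 <;> [skip; push_cast] <;> ring
    · intro y hy
      have : |x - y| = x - y := abs_of_nonneg (by linarith [hy.2])
      simp only [this, ← exp_add]
      congr 1
      push_cast
      ring
  · rw [setIntegral_congr_fun (g := fun y : ℝ => exp (k * x) * exp (-(k + l) * y))
      measurableSet_Ioi, integral_const_mul,
      integral_exp_mul_complex_Ioi (by rw [neg_re]; linarith), neg_div_neg_eq, ← mul_div_assoc,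
      ← exp_add]
    · congr 2
      ring
    · intro y hy
      have : |x - y| = y - x := by rw [abs_of_neg (by linarith [mem_Ioi.mp hy])]; ring
      simp only [this, ← exp_add]
      congr 1
      push_cast
      ring

lemma integrableOn_norm_sq_exp_add_exp {k l : ℂ} (hk : 0 < k.re) (hl : 0 < l.re) (A B : ℂ) :
    IntegrableOn (fun x : ℝ => ‖A * exp (-k * x) + B * exp (-l * x)‖ ^ 2) (Ioi 0) := by
  have hmem : ∀ {k : ℂ}, 0 < k.re → ∀ A : ℂ,
      MemLp (fun x : ℝ => A * exp (-k * x)) 2 (volume.restrict (Ioi 0)) := by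
    intro k hk A
    refine MemLp.const_mul ?_ A
    refine (memLp_two_iff_integrable_sq_norm
      (by fun_prop : Continuous fun x : ℝ => exp (-k * x)).aestronglyMeasurable).mpr ?_
    refine (integrableOn_exp_mul_Ioi (by linarith : -(2 * k.re) < 0) 0).congr_fun ?_
      measurableSet_Ioi
    intro x _
    simp only [Complex.norm_exp, ← Real.exp_nat_mul]
    congr 1
    simp
    ring
  exact (memLp_two_iff_integrable_sq_norm ((hmem hk A).add (hmem hl B)).1).mp
    ((hmem hk A).add (hmem hl B))

/-- The exponential profile `y ↦ exp (-conj (kp z) * y)` on the positive half-line. -/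
noncomputable def expProfile (z : ℂ) (y : ℝ) : ℂ :=
  if 0 < y then exp (-(starRingEnd ℂ (kp z)) * (y : ℂ)) else 0

lemma integral_mul_expProfile (z : ℂ) (g : ℝ → ℂ) :
    ∫ y : ℝ, g y * expProfile z y =
      ∫ y : ℝ in Ioi 0, g y * exp (-(starRingEnd ℂ (kp z)) * (y : ℂ)) := by
  rw [← integral_indicator measurableSet_Ioi]
  refine integral_congr_ae (Filter.Eventually.of_forall fun y => ?_)
  by_cases hy : 0 < y <;> simp [expProfile, hy]

lemma integral_norm_sq_expProfile {z : ℂ} (hz : |z.im| < 1) :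
    ∫ y : ℝ, ‖expProfile z y‖ ^ 2 = 1 / (2 * (kp z).re) := by
  have ha := kp_re_pos hz
  have : (fun y : ℝ => ‖expProfile z y‖ ^ 2) =
      (Ioi 0).indicator fun y : ℝ => Real.exp (-(2 * (kp z).re) * y) := by
    funext y
    by_cases hy : 0 < y
    · simp only [expProfile, hy, if_true, mem_Ioi, indicator_of_mem, Complex.norm_exp,
        ← Real.exp_nat_mul]
      congr 1
      simp
      ring
    · simp [expProfile, hy]
  rw [this, integral_indicator measurableSet_Ioi, integral_exp_mul_Ioi (by linarith)]
  simp

lemma integral_Rker_mul_expProfile_of_neg {z : ℂ} (hz : |z.im| < 1) {x : ℝ} (hx : x < 0) :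
    ∫ y : ℝ, Rker z x y * expProfile z y =
      exp (km z * x) / ((kp z + km z) * (2 * (kp z).re)) := by
  have hs : 0 < (kp z + starRingEnd ℂ (kp z)).re := by
    rw [add_re, conj_re]
    linarith [kp_re_pos hz]
  rw [integral_mul_expProfile, setIntegral_congr_fun
    (g := fun y : ℝ => exp (km z * x) / (kp z + km z) *
      exp (-(kp z + starRingEnd ℂ (kp z)) * y)) measurableSet_Ioi, integral_const_mul,
      integral_exp_mul_complex_Ioi (by rw [neg_re]; linarith), add_conj]
  · simp only [ofReal_zero, mul_zero, exp_zero, ofReal_mul, ofReal_ofNat]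
    rw [neg_div_neg_eq, div_mul_div_comm, mul_one]
  · intro y hy
    have hy : 0 < y := hy
    simp only [Rker, not_le.mpr hx, hx.le, hy.le, false_and, and_self, if_true, if_false]
    rw [div_mul_eq_mul_div, div_mul_eq_mul_div, ← exp_add, ← exp_add]
    congr 2
    ring

lemma exists_integral_Rker_mul_expProfile_of_pos {z : ℂ} (hz : |z.im| < 1) :
    ∃ A B : ℂ, ∀ x : ℝ, 0 < x → ∫ y : ℝ, Rker z x y * expProfile z y =
      A * exp (-(kp z) * x) + B * exp (-(starRingEnd ℂ (kp z)) * x) := by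
  have hs : 0 < (kp z + starRingEnd ℂ (kp z)).re := by
    rw [add_re, conj_re]
    linarith [kp_re_pos hz]
  have hne : kp z ≠ starRingEnd ℂ (kp z) := fun h => by
    have := congrArg im h
    rw [conj_im] at this
    linarith [kp_im_pos hz]
  set k := kp z with hk
  set l := starRingEnd ℂ k
  set C := (k - km z) / (2 * k * (k + km z)) with hC
  refine ⟨-(1 / (k - l)) / (2 * k) + C / (k + l), (1 / (k - l) + 1 / (k + l)) / (2 * k),
    fun x hx => ?_⟩
  rw [integral_mul_expProfile, setIntegral_congr_fun
    (g := fun y : ℝ => 1 / (2 * k) * (exp (-k * (|x - y| : ℝ)) * exp (-l * y)) +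
      C * exp (-k * x) * exp (-(k + l) * y)) measurableSet_Ioi, integral_add,
      integral_const_mul, integral_const_mul, integral_exp_neg_abs_mul_exp hs hne x hx,
      integral_exp_mul_complex_Ioi (by rw [neg_re]; linarith)]
  · simp only [ofReal_zero, mul_zero, exp_zero]
    rw [neg_div_neg_eq]
    ring
  · exact (integrableOn_exp_neg_abs_mul_exp hs x hx).const_mul _
  · exact (integrableOn_exp_mul_complex_Ioi (by rw [neg_re]; linarith) 0).const_mul _
  · intro y hy
    have hy : 0 < y := hy
    simp only [Rker, not_le.mpr hx, hx.le, not_le.mpr hy, false_and, and_false, if_true,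
      if_false, ← hk]
    rw [show -(k + l) * (y : ℂ) = -k * y + -l * y by ring,
      show -k * ((x : ℂ) + y) = -k * x + -k * y by ring, exp_add, exp_add, hC]
    ring

lemma norm_sq_integral_Rker_mul_expProfile_of_neg {z : ℂ} (hz : |z.im| < 1) {x : ℝ}
    (hx : x < 0) :
    ‖∫ y : ℝ, Rker z x y * expProfile z y‖ ^ 2 =
      1 / (‖kp z + km z‖ ^ 2 * (2 * (kp z).re) ^ 2) * Real.exp (2 * (km z).re * x) := by
  have h2 : ‖(2 * ((kp z).re : ℂ))‖ = 2 * (kp z).re := by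
    rw [norm_mul, norm_real, Real.norm_of_nonneg (kp_re_pos hz).le]
    norm_num
  rw [integral_Rker_mul_expProfile_of_neg hz hx, norm_div, norm_mul, h2, div_pow, mul_pow,
    Complex.norm_exp, ← Real.exp_nat_mul, one_div_mul_eq_div]
  congr 2
  simp
  ring

lemma integrable_norm_sq_integral_Rker_mul_expProfile {z : ℂ} (hz : |z.im| < 1) :
    Integrable fun x : ℝ => ‖∫ y : ℝ, Rker z x y * expProfile z y‖ ^ 2 := by
  rw [← integrableOn_univ, ← Iic_union_Ioi (a := (0 : ℝ))]
  refine IntegrableOn.union ?_ ?_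
  · rw [integrableOn_Iic_iff_integrableOn_Iio]
    refine IntegrableOn.congr_fun ?_
      (fun x hx => (norm_sq_integral_Rker_mul_expProfile_of_neg hz hx).symm) measurableSet_Iio
    exact ((integrableOn_exp_mul_Iic (by linarith [km_re_pos hz]) 0).mono_set
      Iio_subset_Iic_self).const_mul _
  · obtain ⟨A, B, hAB⟩ := exists_integral_Rker_mul_expProfile_of_pos hz
    refine (integrableOn_norm_sq_exp_add_exp (kp_re_pos hz)
      (l := starRingEnd ℂ (kp z)) (by rw [conj_re]; exact kp_re_pos hz) A B).congr_fun ?_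
      measurableSet_Ioi
    intro x hx
    simp only [hAB x hx]

lemma div_le_integral_norm_sq_integral_Rker_mul_expProfile {z : ℂ} (hz : |z.im| < 1) :
    1 / (‖kp z + km z‖ ^ 2 * (2 * (kp z).re) ^ 2) * (1 / (2 * (km z).re)) ≤
      ∫ x : ℝ, ‖∫ y : ℝ, Rker z x y * expProfile z y‖ ^ 2 := by
  refine le_trans (le_of_eq ?_) (setIntegral_le_integral (s := Iio 0)
    (integrable_norm_sq_integral_Rker_mul_expProfile hz)
    (Filter.Eventually.of_forall fun x => by positivity))
  rw [setIntegral_congr_fun measurableSet_Iio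
    (fun x hx => norm_sq_integral_Rker_mul_expProfile_of_neg hz hx), integral_const_mul,
    ← integral_Iic_eq_integral_Iio, integral_exp_mul_Iic (by linarith [km_re_pos hz])]
  simp

lemma div_sqrt_mul_sqrt_le_sqrt_integral {z : ℂ} (hz : |z.im| < 1) (hre : 0 < z.re) :
    z.re / √(1 - z.im ^ 2) * √(∫ y : ℝ, ‖expProfile z y‖ ^ 2) ≤
      √(∫ x : ℝ, ‖∫ y : ℝ, Rker z x y * expProfile z y‖ ^ 2) := by
  have ha := kp_re_pos hz
  have hb := km_re_pos hz
  have hd : 0 < 1 - z.im ^ 2 := by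
    have := (sq_lt_one_iff_abs_lt_one z.im).mpr hz
    linarith
  have hN : 0 < ‖kp z + km z‖ ^ 2 := by
    have : 0 < ‖kp z + km z‖ := norm_pos_iff.mpr fun h => by
      have := congrArg re h
      rw [add_re, zero_re] at this
      linarith
    positivity
  refine Real.le_sqrt_of_sq_le
    (le_trans ?_ (div_le_integral_norm_sq_integral_Rker_mul_expProfile hz))
  have key := four_mul_re_mul_re_mul_norm_sq_le hz hre
  rw [mul_pow, div_pow, Real.sq_sqrt hd.le, integral_norm_sq_expProfile hz,
    Real.sq_sqrt (by positivity)]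
  set N := ‖kp z + km z‖ ^ 2
  set a := (kp z).re
  set b := (km z).re
  have h1 : z.re ^ 2 / (1 - z.im ^ 2) ≤ 1 / (4 * a * b * N) := by
    have := one_div_le_one_div_of_le (by positivity) key
    rwa [one_div_div] at this
  calc z.re ^ 2 / (1 - z.im ^ 2) * (1 / (2 * a))
      ≤ 1 / (4 * a * b * N) * (1 / (2 * a)) := by gcongr
    _ = 1 / (N * (2 * a) ^ 2) * (1 / (2 * b)) := by
      field_simp
      ring

theorem stmt6 : ∀ ε : ℝ, 0 < ε → ∃ r₀ : ℝ, 0 < r₀ ∧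
    ∀ z : ℂ, z ∈ Sset → r₀ ≤ z.re →
    ∀ f₀ : ℝ → ℂ,
      (f₀ = fun y : ℝ => if 0 < y then Complex.exp (-(starRingEnd ℂ (kp z)) * (y : ℂ)) else 0) →
      (∫ y : ℝ, ‖f₀ y‖ ^ 2) = 1 / (2 * (kp z).re) ∧
      Real.sqrt (∫ x : ℝ, ‖∫ y : ℝ, Rker z x y * f₀ y‖ ^ 2) ≥
        (1 - ε) * (z.re / Real.sqrt (1 - z.im ^ 2)) * Real.sqrt (∫ y : ℝ, ‖f₀ y‖ ^ 2) := by
  intro ε hε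
  refine ⟨1, one_pos, fun z hz hre f₀ hf₀ => ?_⟩
  have hre : 0 < z.re := by linarith
  obtain rfl : f₀ = expProfile z := hf₀
  refine ⟨integral_norm_sq_expProfile hz.2, ?_⟩
  refine le_trans ?_ (div_sqrt_mul_sqrt_le_sqrt_integral hz.2 hre)
  rw [mul_assoc]
  exact mul_le_of_le_one_left (by positivity) (by linarith)
end
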